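/- Let β > −1, let L ∈ ℕ, and for each l ∈ {1,…,L} let j_l ∈ ℂ with −1 < Re j_l ≤ β, let k_l ∈ ℕ, and let a_l ∈ ℂ. Let φ : (0,∞) → ℂ be smooth with support contained in (0, ξ₀] for some ξ₀ > 0, and suppose the remainder R(ξ) := φ(ξ) − Σ_{l=1}^L a_l ξ^{j_l} (log ξ)^{k_l} satisfies: for every m ∈ ℕ there is C_m with |(ξ d/dξ)^m R(ξ)| ≤ C_m ξ^β for all ξ ∈ (0, 1]. Then φ is integrable on (0,∞), and there is a constant C such that for all τ ≥ 2: |∫_0^∞ e^{iξτ} φ(ξ) dξ − Σ_{l=1}^L a_l τ^{−j_l−1} Σ_{κ=0}^{k_l} c_{j_l,k_l,κ} (log τ)^κ| ≤ C τ^{−β−1}, where c_{j,k,κ} := e^{iπ(j+1)/2} (−1)^κ binom(k,κ) Σ_{m=0}^{k−κ} (iπ/2)^{k−κ−m} binom(k−κ,m) Γ^{(m)}(j+1). -/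

import Mathlib

open MeasureTheory Filter Set Topology

/-- The coefficient `c_{j,k,κ} = e^{iπ(j+1)/2} (-1)^κ C(k,κ)
∑_{m=0}^{k-κ} (iπ/2)^{k-κ-m} C(k-κ,m) Γ^{(m)}(j+1)`. -/
noncomputable def fourierHalfLineCoeff (j : ℂ) (k κ : ℕ) : ℂ :=
  Complex.exp (Complex.I * Real.pi * (j + 1) / 2) * (-1) ^ κ * (k.choose κ) *
    ∑ m ∈ Finset.range (k - κ + 1),
      (Complex.I * Real.pi / 2) ^ (k - κ - m) * ((k - κ).choose m) *
        iteratedDeriv m Complex.Gamma (j + 1)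

/-- The Euler operator `x d/dx` on functions of a real variable. -/
noncomputable def eulerOp (f : ℝ → ℂ) : ℝ → ℂ := fun x => x * deriv f x

lemma ContDiffOn.deriv_Ioi {f : ℝ → ℂ} (hf : ContDiffOn ℝ (⊤ : ℕ∞) f (Ioi 0)) :
    ContDiffOn ℝ (⊤ : ℕ∞) (deriv f) (Ioi 0) :=
  ((contDiffOn_infty_iff_deriv_of_isOpen isOpen_Ioi).1 hf).2

lemma ContDiffOn.differentiableAt_Ioi {f : ℝ → ℂ} (hf : ContDiffOn ℝ (⊤ : ℕ∞) f (Ioi 0))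
    {x : ℝ} (hx : 0 < x) : DifferentiableAt ℝ f x :=
  (hf.differentiableOn (by simp)).differentiableAt (Ioi_mem_nhds hx)

lemma ContDiffOn.eulerOp {f : ℝ → ℂ} (hf : ContDiffOn ℝ (⊤ : ℕ∞) f (Ioi 0)) :
    ContDiffOn ℝ (⊤ : ℕ∞) (eulerOp f) (Ioi 0) :=
  (Complex.ofRealCLM.contDiff.contDiffOn).mul hf.deriv_Ioi

lemma ContDiffOn.iterate_eulerOp {f : ℝ → ℂ} (hf : ContDiffOn ℝ (⊤ : ℕ∞) f (Ioi 0)) (m : ℕ) :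
    ContDiffOn ℝ (⊤ : ℕ∞) (_root_.eulerOp^[m] f) (Ioi 0) := by
  induction m generalizing f with
  | zero => exact hf
  | succ m ih => exact ih hf.eulerOp

lemma Set.EqOn.eulerOp {f g : ℝ → ℂ} {s : Set ℝ} (hs : IsOpen s) (h : EqOn f g s) :
    EqOn (eulerOp f) (eulerOp g) s := fun x hx => by
  simp only [_root_.eulerOp, (h.eventuallyEq_of_mem (hs.mem_nhds hx)).deriv_eq]

lemma Set.EqOn.iterate_eulerOp {f g : ℝ → ℂ} {s : Set ℝ} (hs : IsOpen s) (h : EqOn f g s)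
    (m : ℕ) : EqOn (_root_.eulerOp^[m] f) (_root_.eulerOp^[m] g) s := by
  induction m generalizing f g with
  | zero => exact h
  | succ m ih => exact ih (h.eulerOp hs)

lemma iterate_eulerOp_zero (m : ℕ) : eulerOp^[m] (fun _ => 0) = fun _ => 0 := by
  induction m with
  | zero => rfl
  | succ m ih =>
    rw [Function.iterate_succ_apply, show eulerOp (fun _ => 0) = fun _ => 0 by
      ext x; simp [eulerOp], ih]

lemma iterate_eulerOp_const_mul (c : ℂ) (f : ℝ → ℂ) (m : ℕ) :
    eulerOp^[m] (fun x => c * f x) = fun x => c * eulerOp^[m] f x := by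
  induction m generalizing f with
  | zero => rfl
  | succ m ih =>
    rw [Function.iterate_succ_apply, Function.iterate_succ_apply, ← ih]
    congr 1
    ext x
    simp only [eulerOp, deriv_const_mul_field]
    ring

lemma iterate_eulerOp_add {f g : ℝ → ℂ} (hf : ContDiffOn ℝ (⊤ : ℕ∞) f (Ioi 0))
    (hg : ContDiffOn ℝ (⊤ : ℕ∞) g (Ioi 0)) (m : ℕ) :
    EqOn (eulerOp^[m] (fun x => f x + g x))
      (fun x => eulerOp^[m] f x + eulerOp^[m] g x) (Ioi 0) := by
  induction m generalizing f g with
  | zero => exact fun _ _ => rfl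
  | succ m ih =>
    intro x hx
    simp only [Function.iterate_succ_apply]
    refine Eq.trans ?_ (ih hf.eulerOp hg.eulerOp hx)
    refine Set.EqOn.iterate_eulerOp isOpen_Ioi (fun y hy => ?_) m hx
    simp only [eulerOp]
    rw [deriv_fun_add (hf.differentiableAt_Ioi hy) (hg.differentiableAt_Ioi hy), mul_add]

/-- `f` is smooth on `(0, ∞)` and every `(x d/dx)^m f` is `O(w)` on `s`. -/
def EulerBounded (s : Set ℝ) (w : ℝ → ℝ) (f : ℝ → ℂ) : Prop :=
  ContDiffOn ℝ (⊤ : ℕ∞) f (Ioi 0) ∧ ∀ m : ℕ, ∃ C : ℝ, ∀ x ∈ s, ‖eulerOp^[m] f x‖ ≤ C * w x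

namespace EulerBounded

variable {s : Set ℝ} {w : ℝ → ℝ} {f g : ℝ → ℂ}

lemma zero : EulerBounded s w (fun _ => 0) :=
  ⟨contDiffOn_const, fun m => ⟨0, fun x _ => by simp [iterate_eulerOp_zero]⟩⟩

lemma const_mul (hf : EulerBounded s w f) (c : ℂ) : EulerBounded s w (fun x => c * f x) := by
  refine ⟨contDiffOn_const.mul hf.1, fun m => ?_⟩
  obtain ⟨C, hC⟩ := hf.2 m
  refine ⟨‖c‖ * C, fun x hx => ?_⟩
  rw [iterate_eulerOp_const_mul, norm_mul, mul_assoc]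
  exact mul_le_mul_of_nonneg_left (hC x hx) (norm_nonneg c)

lemma add (hs : s ⊆ Ioi 0) (hf : EulerBounded s w f) (hg : EulerBounded s w g) :
    EulerBounded s w (fun x => f x + g x) := by
  refine ⟨hf.1.add hg.1, fun m => ?_⟩
  obtain ⟨C, hC⟩ := hf.2 m
  obtain ⟨D, hD⟩ := hg.2 m
  refine ⟨C + D, fun x hx => ?_⟩
  rw [iterate_eulerOp_add hf.1 hg.1 m (hs hx), add_mul]
  exact (norm_add_le _ _).trans (add_le_add (hC x hx) (hD x hx))

lemma congr (hs : s ⊆ Ioi 0) (hf : EulerBounded s w f) (h : EqOn g f (Ioi 0)) :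
    EulerBounded s w g := by
  refine ⟨hf.1.congr h, fun m => ?_⟩
  obtain ⟨C, hC⟩ := hf.2 m
  exact ⟨C, fun x hx => by rw [h.iterate_eulerOp isOpen_Ioi m (hs hx)]; exact hC x hx⟩

lemma sub (hs : s ⊆ Ioi 0) (hf : EulerBounded s w f) (hg : EulerBounded s w g) :
    EulerBounded s w (fun x => f x - g x) :=
  (hf.add hs (hg.const_mul (-1))).congr hs fun x _ => by ring

lemma sum {ι : Type*} (hs : s ⊆ Ioi 0) (t : Finset ι) {F : ι → ℝ → ℂ}
    (hF : ∀ i ∈ t, EulerBounded s w (F i)) : EulerBounded s w (fun x => ∑ i ∈ t, F i x) := by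
  classical
  induction t using Finset.induction_on with
  | empty => simpa using zero
  | insert i t hi ih =>
    simp only [Finset.sum_insert hi]
    exact (hF i (by simp)).add hs (ih fun i' hi' => hF i' (by simp [hi']))

lemma eulerOp (hf : EulerBounded s w f) : EulerBounded s w (eulerOp f) :=
  ⟨hf.1.eulerOp, fun m => hf.2 (m + 1)⟩

/-- Differentiation gains a factor `x⁻¹`. -/
lemma deriv (hs : s ⊆ Ioi 0) (hf : EulerBounded s w f) :
    EulerBounded s (fun x => x⁻¹ * w x) (deriv f) := by
  refine ⟨hf.1.deriv_Ioi, fun m => ?_⟩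
  induction m generalizing f with
  | zero =>
    obtain ⟨C, hC⟩ := hf.2 1
    refine ⟨C, fun x hx => ?_⟩
    have hx0 : 0 < x := hs hx
    have h := hC x hx
    simp only [Function.iterate_one, _root_.eulerOp, norm_mul, Complex.norm_real,
      Real.norm_of_nonneg hx0.le] at h
    simp only [Function.iterate_zero, id]
    rw [mul_left_comm, inv_mul_eq_div, le_div_iff₀ hx0]
    linarith
  | succ m ih =>
    obtain ⟨C, hC⟩ := ih hf.eulerOp
    obtain ⟨D, hD⟩ := ih hf
    refine ⟨C + D, fun x hx => ?_⟩
    have hcomm : EqOn (_root_.eulerOp (_root_.deriv f))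
        (fun x => _root_.deriv (_root_.eulerOp f) x + (-1) * _root_.deriv f x) (Ioi 0) := by
      intro y hy
      have h := ((Complex.ofRealCLM.hasDerivAt (x := y)).mul
        (hf.1.deriv_Ioi.differentiableAt_Ioi hy).hasDerivAt).deriv
      have h' : _root_.deriv (_root_.eulerOp f) y
          = _root_.deriv f y + y * _root_.deriv (_root_.deriv f) y := by
        refine Eq.trans ?_ (h.trans ?_)
        · rfl
        · simp
      simp only [h', _root_.eulerOp]
      ring
    rw [Function.iterate_succ_apply, hcomm.iterate_eulerOp isOpen_Ioi m (hs hx),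
      iterate_eulerOp_add hf.1.eulerOp.deriv_Ioi (contDiffOn_const.mul hf.1.deriv_Ioi) m (hs hx),
      iterate_eulerOp_const_mul, add_mul]
    refine (norm_add_le _ _).trans (add_le_add (hC x hx) ?_)
    simpa using hD x hx

end EulerBounded

/-- The model term `x ^ j * (log x) ^ k`. -/
noncomputable def cpowLog (j : ℂ) (k : ℕ) (x : ℝ) : ℂ :=
  Complex.exp (j * Real.log x) * (Real.log x : ℂ) ^ k

lemma hasDerivAt_ofReal_log {x : ℝ} (hx : 0 < x) :
    HasDerivAt (fun y : ℝ => (Real.log y : ℂ)) (x : ℂ)⁻¹ x := by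
  simpa using (Real.hasDerivAt_log hx.ne').ofReal_comp

lemma contDiffOn_cpowLog (j : ℂ) (k : ℕ) :
    ContDiffOn ℝ (⊤ : ℕ∞) (cpowLog j k) (Ioi 0) := by
  have h : ContDiffOn ℝ (⊤ : ℕ∞) (fun y : ℝ => (Real.log y : ℂ)) (Ioi 0) :=
    Complex.ofRealCLM.contDiff.comp_contDiffOn
      (Real.contDiffOn_log.mono fun x hx => (ne_of_gt hx : x ≠ 0))
  exact (contDiffOn_const.mul h).cexp.mul (h.pow k)

lemma eulerOp_cpowLog (j : ℂ) (k : ℕ) :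
    EqOn (eulerOp (cpowLog j k))
      (fun x => j * cpowLog j k x + k * cpowLog j (k - 1) x) (Ioi 0) := by
  intro x hx
  have hx0 : (x : ℂ) ≠ 0 := by exact_mod_cast (ne_of_gt hx : x ≠ 0)
  have h := hasDerivAt_ofReal_log hx
  have h1 : HasDerivAt (cpowLog j k) _ x := (h.const_mul j).cexp.mul (h.pow k)
  simp only [eulerOp, h1.deriv, cpowLog]
  field_simp

lemma norm_cpowLog {j : ℂ} {k : ℕ} {x : ℝ} (hx : 0 < x) :
    ‖cpowLog j k x‖ = x ^ j.re * |Real.log x| ^ k := by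
  rw [cpowLog, norm_mul, norm_pow, Complex.norm_exp, Complex.norm_real, Real.norm_eq_abs,
    Real.rpow_def_of_pos hx]
  simp [mul_comm]

lemma eulerBounded_cpowLog {β : ℝ} {j : ℂ} (hj : j.re ≤ β) (k : ℕ) :
    EulerBounded (Ici 1) (fun x => x ^ (β + 1)) (cpowLog j k) := by
  refine ⟨contDiffOn_cpowLog j k, fun m => ?_⟩
  induction m generalizing k with
  | zero =>
    refine ⟨k.factorial, fun x hx => ?_⟩
    have hx1 : (1 : ℝ) ≤ x := hx
    have hx0 : 0 < x := by linarith
    have hl := Real.log_nonneg hx1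
    have h := Real.pow_div_factorial_le_exp _ hl k
    rw [Real.exp_log hx0, div_le_iff₀ (by positivity)] at h
    simp only [Function.iterate_zero, id]
    rw [norm_cpowLog hx0, abs_of_nonneg hl, Real.rpow_add_one hx0.ne', mul_left_comm,
      mul_comm _ x]
    gcongr
  | succ m ih =>
    obtain ⟨C, hC⟩ := ih k
    obtain ⟨D, hD⟩ := ih (k - 1)
    refine ⟨‖j‖ * C + k * D, fun x hx => ?_⟩
    have hx0 : x ∈ Ioi (0 : ℝ) := mem_Ioi.2 (lt_of_lt_of_le one_pos hx)
    rw [Function.iterate_succ_apply, (eulerOp_cpowLog j k).iterate_eulerOp isOpen_Ioi m hx0,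
      iterate_eulerOp_add (contDiffOn_const.mul (contDiffOn_cpowLog j k))
        (contDiffOn_const.mul (contDiffOn_cpowLog j _)) m hx0,
      iterate_eulerOp_const_mul, iterate_eulerOp_const_mul, add_mul]
    refine (norm_add_le _ _).trans (add_le_add ?_ ?_)
    · rw [norm_mul, mul_assoc]
      exact mul_le_mul_of_nonneg_left (hC x hx) (norm_nonneg _)
    · rw [norm_mul, mul_assoc, Complex.norm_natCast]
      exact mul_le_mul_of_nonneg_left (hD x hx) (Nat.cast_nonneg _)

lemma eulerBounded_of_support {b ξ₀ : ℝ} (hb : 0 ≤ b) {φ : ℝ → ℂ}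
    (hsmooth : ContDiffOn ℝ (⊤ : ℕ∞) φ (Ioi 0)) (hsupp : ∀ ξ : ℝ, ξ₀ < ξ → φ ξ = 0) :
    EulerBounded (Ici 1) (fun x => x ^ b) φ := by
  refine ⟨hsmooth, fun m => ?_⟩
  obtain ⟨C, hC⟩ := (isCompact_Icc (a := (1 : ℝ)) (b := ξ₀)).exists_bound_of_continuousOn
    (f := eulerOp^[m] φ) ((hsmooth.iterate_eulerOp m).continuousOn.mono fun x hx =>
      mem_Ioi.2 (lt_of_lt_of_le one_pos hx.1))
  refine ⟨max C 0, fun x hx => ?_⟩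
  have hx1 : 1 ≤ x ^ b := Real.one_le_rpow hx hb
  rcases le_or_gt x ξ₀ with h | h
  · calc _ ≤ C := hC x ⟨hx, h⟩
      _ ≤ max C 0 * 1 := by simp
      _ ≤ _ := by gcongr
  · have h0 : EqOn φ (fun _ => 0) (Ioi ξ₀) := fun y hy => hsupp y hy
    rw [h0.iterate_eulerOp isOpen_Ioi m h, iterate_eulerOp_zero, norm_zero]
    positivity

lemma norm_cexp_neg_mul (z : ℂ) (t : ℝ) : ‖Complex.exp (-(z * t))‖ = Real.exp (-(z.re * t)) := by
  rw [Complex.norm_exp]; simp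

lemma continuousOn_ofReal_log : ContinuousOn (fun t : ℝ => (Real.log t : ℂ)) (Ioi 0) :=
  fun _ hx => (hasDerivAt_ofReal_log hx).continuousAt.continuousWithinAt

lemma differentiableOn_integral_cpow_mul_exp {s : ℂ} (hs : 0 < s.re) :
    DifferentiableOn ℂ
      (fun z : ℂ => ∫ t : ℝ in Ioi 0, (t : ℂ) ^ (s - 1) * Complex.exp (-(z * t)))
      {z | 0 < z.re} := by
  intro z₀ hz₀
  have hz₀' : 0 < z₀.re := hz₀
  refine DifferentiableAt.differentiableWithinAt ?_
  have hcpow : ContinuousOn (fun t : ℝ => (t : ℂ) ^ (s - 1)) (Ioi 0) := fun t ht =>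
    (Complex.continuousAt_ofReal_cpow_const t (s - 1)
      (Or.inr (ne_of_gt ht))).continuousWithinAt
  have hcont : ∀ z : ℂ, ContinuousOn
      (fun t : ℝ => (t : ℂ) ^ (s - 1) * Complex.exp (-(z * t))) (Ioi 0) := fun z =>
    hcpow.mul (by fun_prop)
  have hbd : ∀ q : ℝ, -1 < q →
      IntegrableOn (fun t : ℝ => t ^ q * Real.exp (-(z₀.re / 2) * t)) (Ioi 0) := fun q hq => by
    have := integrableOn_rpow_mul_exp_neg_mul_rpow (p := 1) hq one_pos (half_pos hz₀')
    simpa using this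
  have hball : ∀ z ∈ Metric.ball z₀ (z₀.re / 2), z₀.re / 2 ≤ z.re := by
    intro z hz
    have h1 := (Complex.abs_re_le_norm (z - z₀)).trans (mem_ball_iff_norm.1 hz).le
    rw [Complex.sub_re] at h1
    linarith [(abs_le.1 h1).1]
  have hpow : ∀ t : ℝ, 0 < t → ‖(t : ℂ) ^ (s - 1)‖ = t ^ (s.re - 1) := fun t ht => by
    rw [Complex.norm_cpow_eq_rpow_re_of_pos ht]; simp
  refine (hasDerivAt_integral_of_dominated_loc_of_deriv_le (μ := volume.restrict (Ioi 0))
    (F := fun z (t : ℝ) => (t : ℂ) ^ (s - 1) * Complex.exp (-(z * t)))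
    (F' := fun z (t : ℝ) => (t : ℂ) ^ (s - 1) * (Complex.exp (-(z * t)) * (-t)))
    (bound := fun t => t ^ s.re * Real.exp (-(z₀.re / 2) * t))
    (Metric.ball_mem_nhds z₀ (half_pos hz₀')) ?_ ?_ ?_ ?_ ?_ ?_).2.differentiableAt
  · exact Eventually.of_forall fun z => (hcont z).aestronglyMeasurable measurableSet_Ioi
  · refine (hbd (s.re - 1) (by linarith)).mono' ((hcont z₀).aestronglyMeasurable
      measurableSet_Ioi) ((ae_restrict_mem measurableSet_Ioi).mono fun t ht => ?_)
    have ht0 : 0 < t := ht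
    rw [norm_mul, norm_cexp_neg_mul, hpow t ht]
    gcongr
    nlinarith
  · exact (hcpow.mul (by fun_prop)).aestronglyMeasurable measurableSet_Ioi
  · refine (ae_restrict_mem measurableSet_Ioi).mono fun t ht z hz => ?_
    have ht0 : 0 < t := ht
    rw [norm_mul, norm_mul, norm_cexp_neg_mul, hpow t ht, norm_neg, Complex.norm_real,
      Real.norm_of_nonneg ht0.le, mul_comm (Real.exp _), ← mul_assoc,
      ← Real.rpow_add_one ht0.ne', sub_add_cancel]
    gcongr
    nlinarith [hball z hz]
  · exact hbd _ (by linarith)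
  · refine Eventually.of_forall fun t z _ => ?_
    have h : HasDerivAt (fun z : ℂ => -(z * t)) (-(t : ℂ)) z := by
      simpa using ((hasDerivAt_id z).mul_const (t : ℂ)).fun_neg
    exact h.cexp.const_mul _

/-- Laplace transform of a power, at a complex frequency in the right half-plane. -/
lemma integral_cpow_mul_exp_neg_mul_Ioi_of_re_pos {s z : ℂ} (hs : 0 < s.re) (hz : 0 < z.re) :
    ∫ t : ℝ in Ioi 0, (t : ℂ) ^ (s - 1) * Complex.exp (-(z * t))
      = Complex.exp (Complex.log (1 / z) * s) * Complex.Gamma s := by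
  have hopen : IsOpen {z : ℂ | 0 < z.re} := isOpen_lt continuous_const Complex.continuous_re
  have hdiff : DifferentiableOn ℂ
      (fun z : ℂ => Complex.exp (Complex.log (1 / z) * s) * Complex.Gamma s)
      {z | 0 < z.re} := by
    intro z hz
    have hz' : 0 < z.re := hz
    have hz0 : z ≠ 0 := by rintro rfl; simp at hz'
    have hslit : 1 / z ∈ Complex.slitPlane := Or.inl (by
      rw [one_div, Complex.inv_re]
      exact div_pos hz' (Complex.normSq_pos.2 hz0))
    exact ((((((differentiableAt_const (1 : ℂ)).div differentiableAt_id hz0).clog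
      hslit).mul_const s).cexp).mul_const _).differentiableWithinAt
  refine ((differentiableOn_integral_cpow_mul_exp hs).analyticOnNhd
    hopen).eqOn_of_preconnected_of_frequently_eq (hdiff.analyticOnNhd hopen)
    (convex_halfSpace_re_gt 0).isPreconnected (z₀ := 1) (by simp) ?_ hz
  have hT : Tendsto (fun r : ℝ => (r : ℂ)) (𝓝[>] 1) (𝓝[≠] (1 : ℂ)) := by
    refine tendsto_nhdsWithin_iff.2 ⟨?_, ?_⟩
    · exact (Complex.continuous_ofReal.tendsto' 1 1 (by simp)).mono_left nhdsWithin_le_nhds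
    · filter_upwards [self_mem_nhdsWithin] with r hr
      simpa using (ne_of_gt hr : r ≠ 1)
  refine hT.frequently (Eventually.frequently ?_)
  filter_upwards [self_mem_nhdsWithin] with r hr
  have hr0 : (0 : ℝ) < r := one_pos.trans hr
  have := Complex.integral_cpow_mul_exp_neg_mul_Ioi hs hr0
  rw [Complex.cpow_def_of_ne_zero (one_div_ne_zero (by exact_mod_cast hr0.ne'))] at this
  exact this

lemma logPow_mul_exp_isBigO_atTop {z : ℂ} (hz : 0 < z.re) (k : ℕ) (a : ℝ) :
    (fun t : ℝ => (Real.log t : ℂ) ^ k * Complex.exp (-(z * t))) =O[atTop]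
      fun t => t ^ (-a) := by
  have h1 : (fun t : ℝ => (Real.log t : ℂ) ^ k) =O[atTop] fun t : ℝ => t :=
    Asymptotics.IsBigO.of_norm_left (by
      simpa [Function.id_def] using
        (Real.isLittleO_pow_log_id_atTop (n := k)).isBigO.norm_left)
  have h2 : (fun t : ℝ => Complex.exp (-(z * t))) =O[atTop] fun t : ℝ => t ^ (-a - 1) :=
    Asymptotics.IsBigO.of_norm_left (by
      simpa only [norm_cexp_neg_mul, neg_mul] using
        (isLittleO_exp_neg_mul_rpow_atTop hz (-a - 1)).isBigO)
  refine (h1.mul h2).congr' EventuallyEq.rfl ?_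
  filter_upwards [eventually_gt_atTop 0] with t ht
  rw [mul_comm, ← Real.rpow_add_one ht.ne', sub_add_cancel]

lemma logPow_mul_exp_isBigO_zero {z : ℂ} (hz : 0 < z.re) (k : ℕ) {b : ℝ} (hb : 0 < b) :
    (fun t : ℝ => (Real.log t : ℂ) ^ k * Complex.exp (-(z * t))) =O[𝓝[>] 0]
      fun t => t ^ (-b) := by
  have h1 := (isLittleO_abs_log_rpow_rpow_nhdsGT_zero k (neg_lt_zero.2 hb)).isBigO
  refine Asymptotics.IsBigO.trans (Asymptotics.IsBigO.of_bound 1 ?_) h1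
  filter_upwards [self_mem_nhdsWithin] with t ht
  have ht0 : 0 < t := ht
  rw [norm_mul, norm_cexp_neg_mul, norm_pow, Complex.norm_real, Real.norm_eq_abs,
    Real.rpow_natCast, Real.norm_of_nonneg (by positivity), one_mul]
  exact mul_le_of_le_one_right (by positivity) (Real.exp_le_one_iff.2 (by nlinarith))

lemma locallyIntegrableOn_logPow_mul_exp (z : ℂ) (k : ℕ) :
    LocallyIntegrableOn (fun t : ℝ => (Real.log t : ℂ) ^ k * Complex.exp (-(z * t))) (Ioi 0) :=
  ((continuousOn_ofReal_log.pow k).mul (by fun_prop)).locallyIntegrableOn measurableSet_Ioi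

lemma mellinConvergent_logPow_mul_exp {s z : ℂ} (hs : 0 < s.re) (hz : 0 < z.re) (k : ℕ) :
    MellinConvergent (fun t : ℝ => (Real.log t : ℂ) ^ k * Complex.exp (-(z * t))) s :=
  mellinConvergent_of_isBigO_rpow (locallyIntegrableOn_logPow_mul_exp z k)
    (logPow_mul_exp_isBigO_atTop hz k (s.re + 1)) (by linarith)
    (logPow_mul_exp_isBigO_zero hz k (half_pos hs)) (by linarith)

lemma hasDerivAt_mellin_logPow_mul_exp {s z : ℂ} (hs : 0 < s.re) (hz : 0 < z.re) (k : ℕ) :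
    HasDerivAt (mellin (fun t : ℝ => (Real.log t : ℂ) ^ k * Complex.exp (-(z * t))))
      (mellin (fun t : ℝ => (Real.log t : ℂ) ^ (k + 1) * Complex.exp (-(z * t))) s) s := by
  have h := (mellin_hasDerivAt_of_isBigO_rpow (s := s) (locallyIntegrableOn_logPow_mul_exp z k)
    (logPow_mul_exp_isBigO_atTop hz k (s.re + 1)) (by linarith)
    (logPow_mul_exp_isBigO_zero hz k (half_pos hs)) (by linarith)).2
  convert! h using 3
  rw [Complex.real_smul, pow_succ]
  ring

lemma iteratedDeriv_mellin_exp {z : ℂ} (hz : 0 < z.re) (k : ℕ) {s : ℂ} (hs : 0 < s.re) :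
    iteratedDeriv k (mellin fun t : ℝ => (Real.log t : ℂ) ^ 0 * Complex.exp (-(z * t))) s
      = mellin (fun t : ℝ => (Real.log t : ℂ) ^ k * Complex.exp (-(z * t))) s := by
  induction k generalizing s with
  | zero => rfl
  | succ k ih =>
    rw [iteratedDeriv_succ, ← (hasDerivAt_mellin_logPow_mul_exp hs hz k).deriv]
    refine EventuallyEq.deriv_eq ?_
    filter_upwards [(isOpen_lt continuous_const Complex.continuous_re).mem_nhds hs] with u hu
      using ih hu

lemma contDiffAt_Gamma {s : ℂ} (hs : 0 < s.re) (n : WithTop ℕ∞) :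
    ContDiffAt ℂ n Complex.Gamma s := by
  have hopen : IsOpen {z : ℂ | 0 < z.re} := isOpen_lt continuous_const Complex.continuous_re
  have : DifferentiableOn ℂ Complex.Gamma {z : ℂ | 0 < z.re} := fun z hz =>
    (Complex.differentiableAt_Gamma z fun m h => by
      have hz' : 0 < z.re := hz
      have : (0 : ℝ) ≤ m := m.cast_nonneg
      rw [h] at hz'
      simp at hz'
      linarith).differentiableWithinAt
  exact (this.analyticOnNhd hopen s hs).contDiffAt

lemma mellin_logPow_mul_exp {s z : ℂ} (hs : 0 < s.re) (hz : 0 < z.re) (k : ℕ) :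
    mellin (fun t : ℝ => (Real.log t : ℂ) ^ k * Complex.exp (-(z * t))) s
      = ∑ m ∈ Finset.range (k + 1), (k.choose m) * iteratedDeriv m Complex.Gamma s *
        (Complex.log (1 / z) ^ (k - m) * Complex.exp (Complex.log (1 / z) * s)) := by
  have h : mellin (fun t : ℝ => (Real.log t : ℂ) ^ 0 * Complex.exp (-(z * t))) =ᶠ[𝓝 s]
      fun u => Complex.Gamma u * Complex.exp (Complex.log (1 / z) * u) := by
    filter_upwards [(isOpen_lt continuous_const Complex.continuous_re).mem_nhds hs] with u hu
    rw [mul_comm, ← integral_cpow_mul_exp_neg_mul_Ioi_of_re_pos hu hz]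
    simp [mellin]
  rw [← iteratedDeriv_mellin_exp hz k hs, h.iteratedDeriv_eq,
    iteratedDeriv_fun_mul (contDiffAt_Gamma hs _) (by fun_prop)]
  simp only [iteratedDeriv_cexp_const_mul]

lemma exp_mul_cpowLog_eq (z j : ℂ) (k : ℕ) {t : ℝ} (ht : 0 < t) :
    (t : ℂ) ^ (j + 1 - 1) • ((Real.log t : ℂ) ^ k * Complex.exp (-(z * t)))
      = Complex.exp (-(z * t)) * cpowLog j k t := by
  rw [add_sub_cancel_right, Complex.cpow_def_of_ne_zero (by exact_mod_cast ht.ne'),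
    ← Complex.ofReal_log ht.le, cpowLog, smul_eq_mul, mul_comm j]
  ring

lemma integrableOn_exp_mul_cpowLog {z j : ℂ} (hj : -1 < j.re) (hz : 0 < z.re) (k : ℕ) :
    IntegrableOn (fun t : ℝ => Complex.exp (-(z * t)) * cpowLog j k t) (Ioi 0) :=
  (integrableOn_congr_fun (fun _ ht => exp_mul_cpowLog_eq z j k ht) measurableSet_Ioi).1
    (mellinConvergent_logPow_mul_exp (s := j + 1) (by simp; linarith) hz k)

lemma integral_exp_mul_cpowLog {z j : ℂ} (hj : -1 < j.re) (hz : 0 < z.re) (k : ℕ) :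
    ∫ t in Ioi (0 : ℝ), Complex.exp (-(z * t)) * cpowLog j k t
      = ∑ m ∈ Finset.range (k + 1), (k.choose m) * iteratedDeriv m Complex.Gamma (j + 1) *
        (Complex.log (1 / z) ^ (k - m) * Complex.exp (Complex.log (1 / z) * (j + 1))) := by
  rw [← mellin_logPow_mul_exp (by simp; linarith) hz k, mellin]
  exact (setIntegral_congr_fun measurableSet_Ioi
    fun _ ht => exp_mul_cpowLog_eq z j k ht).symm

lemma log_one_div_neg_I_mul {τ : ℝ} (hτ : 0 < τ) :
    Complex.log (1 / (-(Complex.I * τ))) = Complex.I * Real.pi / 2 - Real.log τ := by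
  have h : (1 / (-(Complex.I * τ)) : ℂ) = (τ⁻¹ : ℝ) * Complex.I := by
    have : (τ : ℂ) ≠ 0 := by exact_mod_cast hτ.ne'
    field_simp
    simp [this]
  rw [h, Complex.log_ofReal_mul (inv_pos.2 hτ) Complex.I_ne_zero, Complex.log_I, Real.log_inv]
  push_cast
  ring

lemma sum_gamma_eq_fourierHalfLineCoeff (j : ℂ) (k : ℕ) (ℓ : ℂ) :
    ∑ m ∈ Finset.range (k + 1), (k.choose m) * iteratedDeriv m Complex.Gamma (j + 1) *
        ((Complex.I * Real.pi / 2 - ℓ) ^ (k - m) *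
          Complex.exp ((Complex.I * Real.pi / 2 - ℓ) * (j + 1)))
      = Complex.exp (-(j + 1) * ℓ) *
        ∑ κ ∈ Finset.range (k + 1), fourierHalfLineCoeff j k κ * ℓ ^ κ := by
  have hexp : Complex.exp ((Complex.I * Real.pi / 2 - ℓ) * (j + 1))
      = Complex.exp (-(j + 1) * ℓ) * Complex.exp (Complex.I * Real.pi * (j + 1) / 2) := by
    rw [← Complex.exp_add]; ring_nf
  simp only [hexp]
  simp only [fourierHalfLineCoeff, Finset.mul_sum, Finset.sum_mul, sub_eq_neg_add,
    add_pow]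
  refine Finset.sum_comm' (t' := Finset.range (k + 1))
    (s' := fun κ => Finset.range (k - κ + 1)) (fun m κ => ?_) |>.trans
    (Finset.sum_congr rfl fun κ hκ => Finset.sum_congr rfl fun m hm => ?_)
  · simp only [Finset.mem_range]; omega
  · rw [Finset.mem_range] at hκ hm
    have hc : (k.choose m : ℂ) * ((k - m).choose κ) = k.choose κ * ((k - κ).choose m) := by
      have h1 := Nat.choose_mul (n := k) (k := m + κ) (s := m) (by omega)
      have h2 := Nat.choose_mul (n := k) (k := m + κ) (s := κ) (by omega)
      rw [Nat.add_sub_cancel_left] at h1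
      rw [Nat.add_sub_cancel] at h2
      rw [← Nat.choose_symm_add] at h2
      exact_mod_cast h1.symm.trans h2
    rw [neg_pow ℓ, Nat.sub_right_comm k m κ]
    linear_combination (iteratedDeriv m Complex.Gamma (j + 1)) * (-1) ^ κ * ℓ ^ κ *
      (Complex.I * Real.pi / 2) ^ (k - κ - m) * Complex.exp (-(j + 1) * ℓ) *
      Complex.exp (Complex.I * Real.pi * (j + 1) / 2) * hc

/-- The weight `x ^ β` near zero and `x ^ (β + 1)` near infinity. -/
noncomputable def endpointWeight (β x : ℝ) : ℝ := x ^ β * (1 + x)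

namespace EulerBounded

variable {β : ℝ} {f : ℝ → ℂ}

lemma deriv_endpointWeight (hf : EulerBounded (Ioi 0) (endpointWeight β) f) :
    EulerBounded (Ioi 0) (endpointWeight (β - 1)) (_root_.deriv f) := by
  refine ⟨hf.1.deriv_Ioi, fun m => ?_⟩
  obtain ⟨C, hC⟩ := (hf.deriv subset_rfl).2 m
  refine ⟨C, fun x hx => (hC x hx).trans_eq ?_⟩
  have hx0 : 0 < x := hx
  simp only [endpointWeight]
  rw [Real.rpow_sub_one hx0.ne']
  ring

lemma exists_norm_le (hf : EulerBounded (Ioi 0) (endpointWeight β) f) :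
    ∃ C : ℝ, 0 ≤ C ∧ ∀ x : ℝ, 0 < x → ‖f x‖ ≤ C * (x ^ β * (1 + x)) := by
  obtain ⟨C, hC⟩ := hf.2 0
  refine ⟨C, ?_, hC⟩
  have h := (norm_nonneg _).trans (hC 1 (mem_Ioi.2 one_pos))
  rw [endpointWeight, Real.one_rpow] at h
  linarith

lemma continuousOn_exp_mul (hf : EulerBounded (Ioi 0) (endpointWeight β) f) (z : ℂ) :
    ContinuousOn (fun x : ℝ => Complex.exp (-(z * x)) * f x) (Ioi 0) :=
  ContinuousOn.mul (by fun_prop) hf.1.continuousOn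

lemma exp_mul_isBigO (hf : EulerBounded (Ioi 0) (endpointWeight β) f) {z : ℂ} (hz : 0 < z.re) :
    (fun x : ℝ => Complex.exp (-(z * x)) * f x) =O[atTop]
      fun x => Real.exp (-(z.re / 2) * x) := by
  obtain ⟨C, hC0, hC⟩ := hf.exists_norm_le
  have h1 : (fun x : ℝ => f x) =O[atTop] fun x => x ^ (β + 1) := by
    refine Asymptotics.IsBigO.of_bound (C * 2) ?_
    filter_upwards [eventually_ge_atTop 1] with x hx
    have hx0 : 0 < x := by linarith
    refine (hC x hx0).trans ?_
    rw [Real.norm_of_nonneg (by positivity), Real.rpow_add_one hx0.ne', mul_assoc]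
    have : 0 ≤ x ^ β := by positivity
    rw [mul_left_comm 2]
    gcongr
    linarith
  have h2 := h1.trans (isLittleO_rpow_exp_pos_mul_atTop (β + 1) (half_pos hz)).isBigO
  have h3 : (fun x : ℝ => Complex.exp (-(z * x))) =O[atTop]
      fun x => Real.exp (-(z.re * x)) :=
    Asymptotics.IsBigO.of_norm_left (by
      simpa only [norm_cexp_neg_mul] using Asymptotics.isBigO_refl _ _)
  refine (h3.mul h2).congr_right fun x => ?_
  rw [← Real.exp_add]
  ring_nf

lemma integrableOn_exp_mul_Ioi (hf : EulerBounded (Ioi 0) (endpointWeight β) f) {z : ℂ}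
    (hz : 0 < z.re) {c : ℝ} (hc : 0 < c) :
    IntegrableOn (fun x : ℝ => Complex.exp (-(z * x)) * f x) (Ioi c) := by
  have hcont := hf.continuousOn_exp_mul z
  refine (integrable_norm_iff ((hcont.mono
    (Ioi_subset_Ioi hc.le)).aestronglyMeasurable measurableSet_Ioi)).1 ?_
  exact integrable_of_isBigO_exp_neg (half_pos hz)
    (hcont.mono fun x hx => mem_Ioi.2 (hc.trans_le hx)).norm (hf.exp_mul_isBigO hz).norm_left

/-- Integration by parts for the truncated Laplace transform. -/
lemma mul_integral_exp_mul (hf : EulerBounded (Ioi 0) (endpointWeight β) f) {z : ℂ}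
    (hz : 0 < z.re) {c : ℝ} (hc : 0 < c) :
    z * ∫ x in Ioi c, Complex.exp (-(z * x)) * f x
      = Complex.exp (-(z * c)) * f c
        + ∫ x in Ioi c, Complex.exp (-(z * x)) * _root_.deriv f x := by
  have hi := hf.integrableOn_exp_mul_Ioi hz hc
  have hi' := hf.deriv_endpointWeight.integrableOn_exp_mul_Ioi hz hc
  have hd : ∀ x ∈ Ioi c, HasDerivAt (fun x : ℝ => Complex.exp (-(z * x)) * f x)
      (Complex.exp (-(z * x)) * _root_.deriv f x - z * (Complex.exp (-(z * x)) * f x)) x := by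
    intro x hx
    have h1 : HasDerivAt (fun x : ℝ => -(z * x)) (-z) x := by
      simpa using ((Complex.ofRealCLM.hasDerivAt (x := x)).const_mul z).fun_neg
    refine (h1.cexp.mul (hf.1.differentiableAt_Ioi (hc.trans hx)).hasDerivAt).congr_deriv ?_
    ring
  have ht : Tendsto (fun x : ℝ => Complex.exp (-(z * x)) * f x) atTop (𝓝 0) := by
    refine (hf.exp_mul_isBigO hz).trans_tendsto ?_
    refine Real.tendsto_exp_atBot.comp ?_
    exact tendsto_id.const_mul_atTop_of_neg (by linarith)
  have h := integral_Ioi_of_hasDerivAt_of_tendsto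
    ((hf.continuousOn_exp_mul z).continuousAt (Ioi_mem_nhds hc)).continuousWithinAt hd
    (hi'.sub (hi.const_mul z)) ht
  rw [integral_sub hi' (hi.const_mul z), integral_const_mul] at h
  linear_combination -h

/-- Away from the endpoint the Laplace transform is controlled by repeated integration by parts,
uniformly in the half-plane. -/
lemma exists_norm_integral_Ioi_inv_le (N : ℕ) :
    ∀ {β : ℝ} {f : ℝ → ℂ}, EulerBounded (Ioi 0) (endpointWeight β) f → β + 2 < N →
      ∃ C : ℝ, ∀ τ : ℝ, 1 ≤ τ → ∀ z : ℂ, 0 < z.re → τ ≤ ‖z‖ →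
        ‖∫ x in Ioi τ⁻¹, Complex.exp (-(z * x)) * f x‖ ≤ C * τ ^ (-β - 1) := by
  induction N with
  | zero =>
    intro β f hf hβ
    rw [Nat.cast_zero] at hβ
    obtain ⟨C, hC0, hC⟩ := hf.exists_norm_le
    refine ⟨C * (1 / (-β - 1) + 1 / (-β - 2)), fun τ hτ z hz hzτ => ?_⟩
    have hτ0 : 0 < τ := by linarith
    have hc : 0 < τ⁻¹ := inv_pos.2 hτ0
    have hi1 := integrableOn_Ioi_rpow_of_lt (show β < -1 by linarith) hc
    have hi2 := integrableOn_Ioi_rpow_of_lt (show β + 1 < -1 by linarith) hc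
    have hint : ∫ x in Ioi τ⁻¹, C * (x ^ β + x ^ (β + 1))
        = C * (τ ^ (-β - 1) / (-β - 1) + τ ^ (-β - 2) / (-β - 2)) := by
      have e1 : (τ⁻¹) ^ (β + 1) = τ ^ (-β - 1) := by
        rw [Real.inv_rpow hτ0.le, ← Real.rpow_neg hτ0.le]; ring_nf
      have e2 : (τ⁻¹) ^ (β + 1 + 1) = τ ^ (-β - 2) := by
        rw [Real.inv_rpow hτ0.le, ← Real.rpow_neg hτ0.le]; ring_nf
      rw [integral_const_mul, integral_add hi1 hi2,
        integral_Ioi_rpow_of_lt (by linarith) hc, integral_Ioi_rpow_of_lt (by linarith) hc, e1, e2,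
        show -β - 1 = -(β + 1) by ring, show -β - 2 = -(β + 1 + 1) by ring]
      simp only [div_neg, neg_div]
    refine (norm_integral_le_of_norm_le ((hi1.add hi2).const_mul C)
      ((ae_restrict_mem measurableSet_Ioi).mono fun x hx => ?_)).trans (hint.le.trans ?_)
    · have hx0 : 0 < x := hc.trans hx
      rw [norm_mul, norm_cexp_neg_mul]
      refine (mul_le_of_le_one_left (norm_nonneg _)
        (Real.exp_le_one_iff.2 (by nlinarith))).trans ((hC x hx0).trans_eq ?_)
      simp only [Pi.add_apply]
      rw [Real.rpow_add_one hx0.ne']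
      ring
    · have h1 : τ ^ (-β - 2) ≤ τ ^ (-β - 1) :=
        Real.rpow_le_rpow_of_exponent_le hτ (by linarith)
      have h2 : 0 < -β - 2 := by linarith
      rw [mul_assoc, add_mul, div_eq_mul_one_div (τ ^ (-β - 1)), div_eq_mul_one_div (τ ^ (-β - 2)),
        mul_comm (1 / (-β - 1)), mul_comm (1 / (-β - 2))]
      gcongr
  | succ N ih =>
    intro β f hf hβ
    push_cast at hβ
    obtain ⟨C, hC0, hC⟩ := hf.exists_norm_le
    obtain ⟨D, hD⟩ := ih hf.deriv_endpointWeight (by linarith)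
    refine ⟨C * 2 + D, fun τ hτ z hz hzτ => ?_⟩
    have hτ0 : 0 < τ := by linarith
    have hc : 0 < τ⁻¹ := inv_pos.2 hτ0
    have hc1 : τ⁻¹ ≤ 1 := inv_le_one_of_one_le₀ hτ
    have hbdry : ‖Complex.exp (-(z * (τ⁻¹ : ℝ))) * f τ⁻¹‖ ≤ C * 2 * τ ^ (-β) := by
      rw [norm_mul, norm_cexp_neg_mul]
      refine (mul_le_of_le_one_left (norm_nonneg _)
        (Real.exp_le_one_iff.2 (by nlinarith))).trans ((hC _ hc).trans ?_)
      rw [Real.inv_rpow hτ0.le, ← Real.rpow_neg hτ0.le, mul_assoc, mul_comm 2]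
      gcongr
      linarith
    have hder := hD τ hτ z hz hzτ
    rw [show -(β - 1) - 1 = -β by ring] at hder
    have h := congrArg norm (hf.mul_integral_exp_mul hz hc)
    rw [norm_mul] at h
    have hle : τ * ‖∫ x in Ioi τ⁻¹, Complex.exp (-(z * x)) * f x‖ ≤ (C * 2 + D) * τ ^ (-β) := by
      refine (mul_le_mul_of_nonneg_right hzτ (norm_nonneg _)).trans (h.le.trans ?_)
      refine (norm_add_le _ _).trans ?_
      rw [add_mul]
      exact add_le_add hbdry hder
    rw [Real.rpow_sub_one hτ0.ne', ← mul_div_assoc, le_div_iff₀ hτ0]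
    linarith

lemma norm_exp_mul_le {C : ℝ} (hC0 : 0 ≤ C)
    (hC : ∀ x : ℝ, 0 < x → ‖f x‖ ≤ C * (x ^ β * (1 + x)))
    {z : ℂ} (hz : 0 < z.re) {x : ℝ} (hx : x ∈ Ioc (0 : ℝ) 1) :
    ‖Complex.exp (-(z * x)) * f x‖ ≤ C * 2 * x ^ β := by
  have hx0 := hx.1
  rw [norm_mul, norm_cexp_neg_mul]
  refine (mul_le_of_le_one_left (norm_nonneg _)
    (Real.exp_le_one_iff.2 (by nlinarith))).trans ((hC _ hx.1).trans ?_)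
  rw [mul_assoc, mul_comm 2]
  gcongr
  linarith [hx.2]

lemma integrableOn_rpow_Ioc (hβ : -1 < β) {c : ℝ} (hc : 0 ≤ c) :
    IntegrableOn (fun x : ℝ => x ^ β) (Ioc 0 c) :=
  (intervalIntegrable_iff_integrableOn_Ioc_of_le hc).1
    (intervalIntegral.intervalIntegrable_rpow' hβ)

lemma integrableOn_exp_mul (hf : EulerBounded (Ioi 0) (endpointWeight β) f) (hβ : -1 < β) {z : ℂ}
    (hz : 0 < z.re) :
    IntegrableOn (fun x : ℝ => Complex.exp (-(z * x)) * f x) (Ioi 0) := by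
  obtain ⟨C, hC0, hC⟩ := hf.exists_norm_le
  rw [← Ioc_union_Ioi_eq_Ioi zero_le_one]
  refine IntegrableOn.union ?_ (hf.integrableOn_exp_mul_Ioi hz one_pos)
  refine ((integrableOn_rpow_Ioc hβ zero_le_one).const_mul (C * 2)).mono'
    (((hf.continuousOn_exp_mul z).mono Ioc_subset_Ioi_self).aestronglyMeasurable
      measurableSet_Ioc) ((ae_restrict_mem measurableSet_Ioc).mono fun x hx => ?_)
  exact norm_exp_mul_le hC0 hC hz hx

lemma exists_norm_integral_exp_mul_le (hf : EulerBounded (Ioi 0) (endpointWeight β) f)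
    (hβ : -1 < β) :
    ∃ C : ℝ, ∀ τ : ℝ, 1 ≤ τ → ∀ z : ℂ, 0 < z.re → τ ≤ ‖z‖ →
      ‖∫ x in Ioi (0 : ℝ), Complex.exp (-(z * x)) * f x‖ ≤ C * τ ^ (-β - 1) := by
  obtain ⟨N, hN⟩ := exists_nat_gt (β + 2)
  obtain ⟨D, hD⟩ := exists_norm_integral_Ioi_inv_le N hf hN
  obtain ⟨C, hC0, hC⟩ := hf.exists_norm_le
  refine ⟨C * 2 / (β + 1) + D, fun τ hτ z hz hzτ => ?_⟩
  have hτ0 : 0 < τ := by linarith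
  have hc : 0 < τ⁻¹ := inv_pos.2 hτ0
  have hc1 : τ⁻¹ ≤ 1 := inv_le_one_of_one_le₀ hτ
  have hi := hf.integrableOn_exp_mul hβ hz
  rw [← Ioc_union_Ioi_eq_Ioi hc.le, setIntegral_union (Ioc_disjoint_Ioi le_rfl) measurableSet_Ioi
    (hi.mono_set Ioc_subset_Ioi_self) (hi.mono_set (Ioi_subset_Ioi hc.le)), add_mul]
  refine (norm_add_le _ _).trans (add_le_add ?_ (hD τ hτ z hz hzτ))
  refine (norm_integral_le_of_norm_le ((integrableOn_rpow_Ioc hβ hc.le).const_mul (C * 2))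
    ((ae_restrict_mem measurableSet_Ioc).mono fun x hx =>
      norm_exp_mul_le hC0 hC hz ⟨hx.1, hx.2.trans hc1⟩)).trans_eq ?_
  rw [integral_const_mul, ← intervalIntegral.integral_of_le hc.le, integral_rpow (Or.inl hβ),
    Real.zero_rpow (by linarith), Real.inv_rpow hτ0.le, ← Real.rpow_neg hτ0.le, neg_add']
  ring

lemma of_Ioc_of_Ici (h0 : EulerBounded (Ioc 0 1) (fun x => x ^ β) f)
    (h1 : EulerBounded (Ici 1) (fun x => x ^ (β + 1)) f) :
    EulerBounded (Ioi 0) (endpointWeight β) f := by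
  refine ⟨h0.1, fun m => ?_⟩
  obtain ⟨C, hC⟩ := h0.2 m
  obtain ⟨D, hD⟩ := h1.2 m
  refine ⟨max (max C D) 0, fun x hx => ?_⟩
  have hx0 : 0 < x := hx
  have hpos : 0 < x ^ β := by positivity
  rw [endpointWeight]
  rcases le_total x 1 with h | h
  · refine (hC x ⟨hx0, h⟩).trans ?_
    gcongr
    · exact (le_max_left _ _).trans (le_max_left _ _)
    · nlinarith
  · refine (hD x h).trans ?_
    simp only [Real.rpow_add_one hx0.ne']
    gcongr
    · exact (le_max_right _ _).trans (le_max_left _ _)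
    · linarith

end EulerBounded

/-- Large-frequency expansion of the Fourier transform of a compactly
supported function on the half-line that is polyhomogeneous at `0` to order `β`: if
`φ : (0,∞) → ℂ` is smooth, supported in `(0, ξ₀]`, and
`R(ξ) = φ(ξ) - ∑_l a_l ξ^{j_l} (log ξ)^{k_l}` satisfies
`|(ξ d/dξ)^m R(ξ)| ≤ C_m ξ^β` on `(0,1]` for every `m`, then `φ` is integrable on `(0,∞)` and
`|∫_0^∞ e^{iξτ} φ(ξ) dξ - ∑_l a_l τ^{-j_l-1} ∑_{κ=0}^{k_l} c_{j_l,k_l,κ} (log τ)^κ|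
  ≤ C τ^{-β-1}` for all `τ ≥ 2`. -/
theorem stmt13 (β : ℝ) (hβ : -1 < β) (L : ℕ) (j : Fin L → ℂ) (k : Fin L → ℕ) (a : Fin L → ℂ)
    (hj : ∀ l, -1 < (j l).re ∧ (j l).re ≤ β)
    (φ : ℝ → ℂ) (ξ₀ : ℝ) (hξ₀ : 0 < ξ₀)
    (hsmooth : ContDiffOn ℝ (⊤ : ℕ∞) φ (Ioi 0))
    (hsupp : ∀ ξ : ℝ, ξ₀ < ξ → φ ξ = 0)
    (hrem : ∀ m : ℕ, ∃ Cm : ℝ, ∀ ξ ∈ Ioc (0 : ℝ) 1,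
      ‖(fun f : ℝ → ℂ => fun x : ℝ => x * deriv f x)^[m]
          (fun ξ' : ℝ => φ ξ' -
            ∑ l, a l * Complex.exp (j l * Real.log ξ') * (Real.log ξ' : ℂ) ^ (k l)) ξ‖ ≤
        Cm * ξ ^ β) :
    IntegrableOn φ (Ioi 0) ∧
    ∃ C : ℝ, ∀ τ : ℝ, 2 ≤ τ →
      ‖(∫ ξ in Ioi (0 : ℝ), Complex.exp (Complex.I * ξ * τ) * φ ξ) -
          ∑ l, a l * Complex.exp (-(j l + 1) * Real.log τ) *
            ∑ κ ∈ Finset.range (k l + 1),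
              fourierHalfLineCoeff (j l) (k l) κ * (Real.log τ : ℂ) ^ κ‖ ≤
        C * τ ^ (-β - 1) := by
  set M : ℝ → ℂ := fun x => ∑ l, a l * cpowLog (j l) (k l) x with hM
  set R : ℝ → ℂ := fun x => φ x - M x with hR
  have hMb : EulerBounded (Ici 1) (fun x => x ^ (β + 1)) M :=
    EulerBounded.sum (fun x hx => mem_Ioi.2 (one_pos.trans_le hx)) _ fun l _ =>
      (eulerBounded_cpowLog (hj l).2 (k l)).const_mul (a l)
  have hRb : EulerBounded (Ioi 0) (endpointWeight β) R := by
    refine EulerBounded.of_Ioc_of_Ici ⟨hsmooth.sub hMb.1, fun m => ?_⟩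
      ((eulerBounded_of_support (by linarith) hsmooth hsupp).sub
        (fun x hx => mem_Ioi.2 (one_pos.trans_le hx)) hMb)
    obtain ⟨C, hC⟩ := hrem m
    refine ⟨C, fun x hx => ?_⟩
    have h := hC x hx
    simp only [mul_assoc] at h
    exact h
  have hMint : ∀ z : ℂ, 0 < z.re → ∀ l ∈ Finset.univ, IntegrableOn
      (fun x : ℝ => a l * (Complex.exp (-(z * x)) * cpowLog (j l) (k l) x)) (Ioi 0) :=
    fun z hz l _ => (integrableOn_exp_mul_cpowLog (hj l).1 hz (k l)).const_mul (a l)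
  have hdecomp : ∀ z : ℂ, (fun x : ℝ => Complex.exp (-(z * x)) * φ x) = fun x : ℝ =>
      Complex.exp (-(z * x)) * R x +
        ∑ l, a l * (Complex.exp (-(z * x)) * cpowLog (j l) (k l) x) := by
    intro z
    ext x
    simp only [hR, hM, mul_sub, Finset.mul_sum, mul_left_comm (a _)]
    ring
  have hφcont : AEStronglyMeasurable φ (volume.restrict (Ioi 0)) :=
    hsmooth.continuousOn.aestronglyMeasurable measurableSet_Ioi
  have hφint : IntegrableOn φ (Ioi 0) := by
    have h1 : IntegrableOn (fun x : ℝ => Complex.exp (-((1 : ℂ) * x)) * φ x) (Ioi 0) := by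
      rw [hdecomp]
      exact (hRb.integrableOn_exp_mul hβ (by simp)).add
        (integrable_finsetSum _ (hMint 1 (by simp)))
    refine (h1.norm.const_mul (Real.exp ξ₀)).mono' hφcont (Eventually.of_forall fun x => ?_)
    rw [norm_mul, norm_cexp_neg_mul, ← mul_assoc, ← Real.exp_add]
    rcases le_or_gt x ξ₀ with h | h
    · exact le_mul_of_one_le_left (norm_nonneg _) (Real.one_le_exp (by simpa using h))
    · simp [hsupp x h]
  refine ⟨hφint, ?_⟩
  obtain ⟨C, hC⟩ := hRb.exists_norm_integral_exp_mul_le hβ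
  refine ⟨C, fun τ hτ => ?_⟩
  have hτ0 : 0 < τ := by linarith
  let S : ℂ → ℂ := fun w => ∑ l, a l * ∑ m ∈ Finset.range (k l + 1),
    ((k l).choose m) * iteratedDeriv m Complex.Gamma (j l + 1) *
      (w ^ (k l - m) * Complex.exp (w * (j l + 1)))
  let z : ℝ → ℂ := fun ε => ε - Complex.I * τ
  have hzre : ∀ ε, (z ε).re = ε := fun ε => by simp [z]
  have hbound : ∀ ε : ℝ, 0 < ε →
      ‖(∫ x in Ioi (0 : ℝ), Complex.exp (-(z ε * x)) * φ x) - S (Complex.log (1 / z ε))‖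
        ≤ C * τ ^ (-β - 1) := by
    intro ε hε
    have hz : 0 < (z ε).re := by rwa [hzre]
    have hτz : τ ≤ ‖z ε‖ := by
      have h := Complex.abs_im_le_norm (z ε)
      rw [show (z ε).im = -τ by simp [z], abs_neg, abs_of_pos hτ0] at h
      exact h
    have hS : ∫ x in Ioi (0 : ℝ), Complex.exp (-(z ε * x)) * φ x
        = (∫ x in Ioi (0 : ℝ), Complex.exp (-(z ε * x)) * R x) + S (Complex.log (1 / z ε)) := by
      rw [hdecomp, integral_add (hRb.integrableOn_exp_mul hβ hz)
        (integrable_finsetSum _ (hMint _ hz)), integral_finsetSum _ (hMint _ hz)]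
      simp only [S, integral_const_mul]
      congr 1
      exact Finset.sum_congr rfl fun l _ => by rw [integral_exp_mul_cpowLog (hj l).1 hz]
    rw [hS, add_sub_cancel_right]
    exact hC τ (by linarith) _ hz hτz
  have hzlim : Tendsto z (𝓝[>] 0) (𝓝 (-(Complex.I * τ))) :=
    (Continuous.tendsto' (by fun_prop) 0 _ (by simp [z])).mono_left nhdsWithin_le_nhds
  have hlim1 : Tendsto (fun ε => ∫ x in Ioi (0 : ℝ), Complex.exp (-(z ε * x)) * φ x) (𝓝[>] 0)
      (𝓝 (∫ x in Ioi (0 : ℝ), Complex.exp (Complex.I * x * τ) * φ x)) := by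
    refine tendsto_integral_filter_of_dominated_convergence (fun x => ‖φ x‖) ?_ ?_ hφint.norm ?_
    · exact Eventually.of_forall fun ε =>
        (Continuous.aestronglyMeasurable (by fun_prop)).mul hφcont
    · filter_upwards [self_mem_nhdsWithin] with ε hε
      refine (ae_restrict_mem measurableSet_Ioi).mono fun x hx => ?_
      rw [norm_mul, norm_cexp_neg_mul, hzre]
      exact mul_le_of_le_one_left (norm_nonneg _)
        (Real.exp_le_one_iff.2 (neg_nonpos.2 (mul_pos hε hx).le))
    · refine Eventually.of_forall fun x => Tendsto.mul_const _ ?_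
      rw [show Complex.I * x * τ = -(-(Complex.I * τ) * x) by ring]
      exact (hzlim.mul_const _).neg.cexp
  have hlim2 : Tendsto (fun ε => S (Complex.log (1 / z ε))) (𝓝[>] 0)
      (𝓝 (S (Complex.I * Real.pi / 2 - Real.log τ))) := by
    have hScont : Continuous S := by fun_prop
    refine (hScont.tendsto _).comp ?_
    rw [← log_one_div_neg_I_mul hτ0]
    have hne : -(Complex.I * τ) ≠ 0 := by simp [hτ0.ne']
    refine Tendsto.clog (tendsto_const_nhds.div hzlim hne) (Or.inr ?_)
    simp [Complex.inv_im, hτ0.ne']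
  have hfin := le_of_tendsto (hlim1.sub hlim2).norm
    (by filter_upwards [self_mem_nhdsWithin] with ε hε using hbound ε hε)
  convert! hfin using 4
  rw [sum_gamma_eq_fourierHalfLineCoeff, mul_assoc]
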